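/- arXiv:2104.12733 — 4 statements merged into one kernel-verified Lean document; each statement's English description precedes it below -/
import Mathlib

section
/- Let X = [1,2] × [1,2] ⊂ ℝ² and let f : X → ℝ be defined by f(x,y) = x/y. Then f is continuous on X, f satisfies f(tx,ty) = f(x,y) whenever (x,y) and (tx,ty) both lie in the positive quadrant, and for every constant c ∈ ℝ, sup_{(x,y) ∈ X} |f(x,y) − c| ≥ 3/4. In particular, f cannot be uniformly approximated on X to accuracy 3/4 by ℝ^×-scaling-invariant polynomials, all of which are constant. -/
/-- **The counterexample `f(x,y) = x/y` on `X = [1,2] × [1,2]`.**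
The function `f(x,y) = x/y` is continuous on `X`, is invariant under scaling within the
positive quadrant, and cannot be uniformly approximated on `X` to accuracy `3/4` by any
constant: for every `c ∈ ℝ` there is a point of `X` where `|f - c| ≥ 3/4`. (The
ℝ^×-scaling-invariant polynomials are exactly the constants, so `f` cannot be approximated
by invariant polynomials.) -/
theorem counterexample_x_div_y :
    ContinuousOn (fun z : ℝ × ℝ => z.1 / z.2) (Set.Icc 1 2 ×ˢ Set.Icc 1 2) ∧
    (∀ t x y : ℝ, 0 < x → 0 < y → 0 < t * x → 0 < t * y →
      (t * x) / (t * y) = x / y) ∧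
    (∀ c : ℝ, ∃ z ∈ (Set.Icc 1 2 ×ˢ Set.Icc 1 2 : Set (ℝ × ℝ)),
      3 / 4 ≤ |z.1 / z.2 - c|) := by
  refine ⟨?_, ?_, ?_⟩
  · refine continuousOn_fst.div continuousOn_snd fun z hz => ?_
    exact (zero_lt_one.trans_le hz.2.1).ne'
  · intro t x y _ _ _ hty
    exact mul_div_mul_left x y (left_ne_zero_of_mul hty.ne')
  · intro c
    rcases le_total c (5 / 4) with hc | hc
    · refine ⟨(2, 1), by norm_num, le_abs.2 (Or.inl ?_)⟩
      norm_num
      linarith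
    · refine ⟨(1, 2), by norm_num, le_abs.2 (Or.inr ?_)⟩
      norm_num
      linarith
end

section
/- Let p ∈ ℂ[x_1,…,x_n] be a polynomial such that for every real orthogonal matrix M ∈ O(n,ℝ) (i.e. M has real entries and MᵀM = I), p(Mx) = p(x) for all x ∈ ℂ^n (where M acts on ℂ^n via its entries regarded as complex numbers). Then for every complex orthogonal matrix M ∈ O(n,ℂ) (i.e. M has complex entries and MᵀM = I), p(Mx) = p(x) for all x ∈ ℂ^n. -/
open Matrix

namespace Matrix

variable {ι K : Type*} [Fintype ι] [DecidableEq ι] [Field K]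

/-- The matrix of the reflection along `v`, with respect to the standard bilinear form. -/
noncomputable def householder (v : ι → K) : Matrix ι ι K :=
  1 - (2 / (v ⬝ᵥ v)) • vecMulVec v v

lemma householder_mulVec (v x : ι → K) :
    householder v *ᵥ x = x - (2 / (v ⬝ᵥ v) * (v ⬝ᵥ x)) • v := by
  ext i
  simp [householder, sub_mulVec, smul_mulVec, vecMulVec_mulVec]
  ring

lemma householder_mulVec_of_dotProduct_eq_zero {v x : ι → K} (h : v ⬝ᵥ x = 0) :
    householder v *ᵥ x = x := by
  simp [householder_mulVec, h]

lemma householder_transpose_mul_self {v : ι → K} (hv : v ⬝ᵥ v ≠ 0) :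
    (householder v)ᵀ * householder v = 1 := by
  have hsymm : (householder v)ᵀ = householder v := by
    simp [householder, transpose_vecMulVec]
  rw [hsymm]
  refine ext_of_mulVec_single fun i => ?_
  rw [← mulVec_mulVec, householder_mulVec v (householder v *ᵥ _), householder_mulVec, one_mulVec]
  ext j
  simp only [dotProduct_sub, dotProduct_smul, smul_eq_mul, Pi.sub_apply, Pi.smul_apply]
  field_simp
  ring

/-- The reflection along `a - b` exchanges two vectors `a` and `b` of the same length. -/
lemma householder_sub_mulVec {a b : ι → K} (hab : a ⬝ᵥ a = b ⬝ᵥ b)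
    (h : (a - b) ⬝ᵥ (a - b) ≠ 0) : householder (a - b) *ᵥ a = b := by
  have hlen : (a - b) ⬝ᵥ (a - b) = 2 * ((a - b) ⬝ᵥ a) := by
    simp only [sub_dotProduct, dotProduct_sub, ← hab, dotProduct_comm a b]
    ring
  have hc : 2 / ((a - b) ⬝ᵥ (a - b)) * ((a - b) ⬝ᵥ a) = 1 := by
    rw [div_mul_eq_mul_div, ← hlen, div_self h]
  rw [householder_mulVec, hc]
  simp

end Matrix

namespace MvPolynomial

/-- Polynomials are determined by their values at real points. -/
lemma eq_of_eval_ofReal {σ : Type*} {P Q : MvPolynomial σ ℂ}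
    (h : ∀ v : σ → ℝ, eval (fun i => (v i : ℂ)) P = eval (fun i => (v i : ℂ)) Q) : P = Q := by
  refine funext_set (fun _ => Set.range ((↑) : ℝ → ℂ))
    (fun _ => Set.infinite_range_of_injective Complex.ofReal_injective) fun x hx => ?_
  choose v hv using fun i => hx i (Set.mem_univ i)
  obtain rfl : (fun i => (v i : ℂ)) = x := _root_.funext hv
  exact h v

variable {ι : Type*} [Fintype ι]

/-- Invariance of a polynomial under a linear change of variables. -/
def IsInvariantUnder (p : MvPolynomial ι ℂ) (M : Matrix ι ι ℂ) : Prop :=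
  ∀ x : ι → ℂ, eval (M *ᵥ x) p = eval x p

variable {p : MvPolynomial ι ℂ}

lemma IsInvariantUnder.mul {M N : Matrix ι ι ℂ} (hM : p.IsInvariantUnder M)
    (hN : p.IsInvariantUnder N) : p.IsInvariantUnder (M * N) := fun x => by
  rw [← mulVec_mulVec, hM, hN]

variable [DecidableEq ι]

/-- Clearing denominators in the reflection formula leaves an identity that is polynomial in the
reflection vector. -/
lemma eval_dotProduct_smul_sub
    (hp : ∀ M : Matrix ι ι ℝ, Mᵀ * M = 1 → p.IsInvariantUnder (M.map (fun a : ℝ => (a : ℂ))))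
    (v y : ι → ℂ) :
    eval ((v ⬝ᵥ v) • y - (2 * (v ⬝ᵥ y)) • v) p = eval ((v ⬝ᵥ v) • y) p := by
  let q : MvPolynomial ι ℂ := ∑ j, X j * X j
  let l : MvPolynomial ι ℂ := ∑ j, X j * C (y j)
  have hq (u : ι → ℂ) : eval u q = u ⬝ᵥ u := by simp [q, dotProduct]
  have hl (u : ι → ℂ) : eval u l = u ⬝ᵥ y := by simp [l, dotProduct]
  have hL (u : ι → ℂ) : eval u (bind₁ (fun i => q * C (y i) - C 2 * l * X i) p) =
      eval ((u ⬝ᵥ u) • y - (2 * (u ⬝ᵥ y)) • u) p := by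
    rw [eval, eval₂Hom_bind₁]
    congr 2
    ext i
    change eval u (q * C (y i) - C 2 * l * X i) = _
    simp [hq, hl]
  have hR (u : ι → ℂ) : eval u (bind₁ (fun i => q * C (y i)) p) = eval ((u ⬝ᵥ u) • y) p := by
    rw [eval, eval₂Hom_bind₁]
    congr 2
    ext i
    change eval u (q * C (y i)) = _
    simp [hq]
  rw [← hL, ← hR]
  refine congrArg (eval v) (eq_of_eval_ofReal fun u => ?_)
  rw [hL, hR]
  obtain rfl | hu := eq_or_ne u 0
  · simp [dotProduct]
  have hu' : u ⬝ᵥ u ≠ 0 := by rwa [Ne, dotProduct_self_eq_zero]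
  have hcast : (fun i => (u i : ℂ)) ⬝ᵥ (fun i => (u i : ℂ)) = ((u ⬝ᵥ u : ℝ) : ℂ) := by
    simp [dotProduct]
  have hmap : (householder u).map (fun a : ℝ => (a : ℂ)) = householder fun i => (u i : ℂ) := by
    ext i j
    simp [householder, hcast, one_apply, vecMulVec_apply, apply_ite]
  have hne : ((u ⬝ᵥ u : ℝ) : ℂ) ≠ 0 := by exact_mod_cast hu'
  have := hp _ (householder_transpose_mul_self hu') (((u ⬝ᵥ u : ℝ) : ℂ) • y)
  rw [hmap, householder_mulVec, hcast, dotProduct_smul, smul_eq_mul, ← mul_assoc,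
    div_mul_cancel₀ _ hne] at this
  rw [hcast, this]

lemma isInvariantUnder_householder
    (hp : ∀ M : Matrix ι ι ℝ, Mᵀ * M = 1 → p.IsInvariantUnder (M.map (fun a : ℝ => (a : ℂ))))
    {v : ι → ℂ} (hv : v ⬝ᵥ v ≠ 0) : p.IsInvariantUnder (householder v) := fun x => by
  have := eval_dotProduct_smul_sub hp v ((v ⬝ᵥ v)⁻¹ • x)
  rw [smul_inv_smul₀ hv, dotProduct_smul, smul_eq_mul, ← mul_assoc, ← div_eq_mul_inv] at this
  rw [householder_mulVec, this]

/-- Unit vectors are exchanged by products of at most two reflections, which fix every vector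
orthogonal to both. -/
lemma exists_isInvariantUnder_mulVec_eq
    (hp : ∀ v : ι → ℂ, v ⬝ᵥ v ≠ 0 → p.IsInvariantUnder (householder v))
    {a b : ι → ℂ} (ha : a ⬝ᵥ a = 1) (hb : b ⬝ᵥ b = 1) :
    ∃ N : Matrix ι ι ℂ, Nᵀ * N = 1 ∧ p.IsInvariantUnder N ∧ N *ᵥ a = b ∧
      ∀ u, a ⬝ᵥ u = 0 → b ⬝ᵥ u = 0 → N *ᵥ u = u := by
  by_cases h : (a - b) ⬝ᵥ (a - b) = 0
  · have hsum : (a - -b) ⬝ᵥ (a - -b) ≠ 0 := by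
      have : (a - -b) ⬝ᵥ (a - -b) = 4 := by
        simp only [sub_dotProduct, dotProduct_sub, neg_dotProduct, dotProduct_neg,
          dotProduct_comm b a, ha, hb] at h ⊢
        linear_combination -h
      rw [this]
      norm_num
    have hb0 : b ⬝ᵥ b ≠ 0 := by simp [hb]
    refine ⟨householder b * householder (a - -b), ?_, (hp b hb0).mul (hp _ hsum), ?_, ?_⟩
    · rw [transpose_mul, Matrix.mul_assoc, ← Matrix.mul_assoc _ (householder b),
        householder_transpose_mul_self hb0, Matrix.one_mul, householder_transpose_mul_self hsum]
    · rw [← mulVec_mulVec, householder_sub_mulVec (by simp [ha, hb]) hsum, mulVec_neg,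
        householder_mulVec, hb]
      ext i
      simp
      ring
    · intro u hau hbu
      rw [← mulVec_mulVec,
        householder_mulVec_of_dotProduct_eq_zero (v := a - -b) (by simp [hau, hbu]),
        householder_mulVec_of_dotProduct_eq_zero hbu]
  · exact ⟨householder (a - b), householder_transpose_mul_self h, hp _ h,
      householder_sub_mulVec (ha.trans hb.symm) h, fun u hau hbu =>
        householder_mulVec_of_dotProduct_eq_zero (by simp [sub_dotProduct, hau, hbu])⟩

/-- A polynomial invariant under all reflections is invariant under every orthogonal matrix fixing
all but the last `m` standard basis vectors. -/
lemma isInvariantUnder_of_householder {n : ℕ} {p : MvPolynomial (Fin n) ℂ}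
    (hp : ∀ v : Fin n → ℂ, v ⬝ᵥ v ≠ 0 → p.IsInvariantUnder (householder v)) (m : ℕ)
    {M : Matrix (Fin n) (Fin n) ℂ} (hM : Mᵀ * M = 1)
    (hfix : ∀ i : Fin n, i.val + m < n → M *ᵥ Pi.single i 1 = Pi.single i 1) :
    p.IsInvariantUnder M := by
  induction m generalizing M with
  | zero =>
    obtain rfl : M = 1 := ext_of_mulVec_single fun i => by
      rw [hfix i (by simp), one_mulVec]
    intro x
    rw [one_mulVec]
  | succ m ih =>
    by_cases hm : n ≤ m
    · exact ih hM fun i hi => by omega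
    let k : Fin n := ⟨n - (m + 1), by omega⟩
    have hdot (u w : Fin n → ℂ) : (M *ᵥ u) ⬝ᵥ (M *ᵥ w) = u ⬝ᵥ w := by
      rw [dotProduct_mulVec, ← mulVec_transpose, mulVec_mulVec, hM, one_mulVec]
    obtain ⟨N, hN, hpN, hNk, hNfix⟩ := exists_isInvariantUnder_mulVec_eq hp
      (a := M *ᵥ Pi.single k 1) (b := Pi.single k 1) (by rw [hdot]; simp) (by simp)
    have hNM : p.IsInvariantUnder (N * M) := by
      refine ih ?_ fun i hi => ?_
      · rw [transpose_mul, Matrix.mul_assoc, ← Matrix.mul_assoc _ N, hN, Matrix.one_mul, hM]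
      rw [← mulVec_mulVec]
      obtain rfl | hik := eq_or_ne i k
      · exact hNk
      have hi' : i.val + (m + 1) < n := by
        have : i.val ≠ n - (m + 1) := fun h => hik (Fin.ext h)
        omega
      have horth : (Pi.single k 1 : Fin n → ℂ) ⬝ᵥ Pi.single i 1 = 0 := by
        simp [hik.symm]
      rw [hfix i hi']
      refine hNfix _ ?_ horth
      rw [← hfix i hi', hdot, horth]
    intro x
    rw [← hpN, mulVec_mulVec, hNM]

end MvPolynomial

/-- **`O(n,ℝ)`-invariance implies `O(n,ℂ)`-invariance for complex polynomials.**
If `p ∈ ℂ[x₁,…,xₙ]` satisfies `p(Mx) = p(x)` for every real orthogonal matrix `M`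
(acting on `ℂ^n` via its entries regarded as complex numbers), then `p(Mx) = p(x)` for
every complex orthogonal matrix `M`. An instance of: the invariants of a linearly
reductive group over `ℂ` coincide with those of its maximal compact subgroup. -/
theorem real_orthogonal_invariance_extends
    {n : ℕ} (p : MvPolynomial (Fin n) ℂ)
    (hinv : ∀ M : Matrix (Fin n) (Fin n) ℝ, Mᵀ * M = 1 →
      ∀ x : Fin n → ℂ,
        MvPolynomial.eval ((M.map (fun a : ℝ => (a : ℂ))).mulVec x) p =
          MvPolynomial.eval x p) :
    ∀ M : Matrix (Fin n) (Fin n) ℂ, Mᵀ * M = 1 →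
      ∀ x : Fin n → ℂ,
        MvPolynomial.eval (M.mulVec x) p = MvPolynomial.eval x p := by
  intro M hM
  exact MvPolynomial.isInvariantUnder_of_householder
    (fun v hv => MvPolynomial.isInvariantUnder_householder hinv hv) n hM fun i hi => by omega
end

section
/- Let p ∈ ℂ[x_1,…,x_n] be a polynomial such that for every real special orthogonal matrix M ∈ SO(n,ℝ) (i.e. M has real entries, MᵀM = I, and det M = 1), p(Mx) = p(x) for all x ∈ ℂ^n (where M acts on ℂ^n via its entries regarded as complex numbers). Then for every complex special orthogonal matrix M ∈ SO(n,ℂ) (i.e. M has complex entries, MᵀM = I, and det M = 1), p(Mx) = p(x) for all x ∈ ℂ^n. -/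
open Matrix

/-- Two restrictions of a polynomial to affine lines that agree at real parameters agree at all
complex parameters. -/
lemma MvPolynomial.eval_line_eq_of_real {σ : Type*} (p q : MvPolynomial σ ℂ) (u v w z : σ → ℂ)
    (h : ∀ t : ℝ, MvPolynomial.eval (u + (t : ℂ) • v) p = MvPolynomial.eval (w + (t : ℂ) • z) q)
    (t : ℂ) : MvPolynomial.eval (u + t • v) p = MvPolynomial.eval (w + t • z) q := by
  have key : ∀ (r : MvPolynomial σ ℂ) (a b : σ → ℂ) (s : ℂ),
      Polynomial.eval s (MvPolynomial.aeval
        (fun i => Polynomial.C (a i) + Polynomial.C (b i) * Polynomial.X) r) =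
      MvPolynomial.eval (a + s • b) r := by
    intro r a b s
    induction r using MvPolynomial.induction_on with
    | C c => simp
    | add f g hf hg => simp [hf, hg]
    | mul_X f i hf => simp [hf, mul_comm s]
  rw [← key, ← key]
  congr 1
  apply Polynomial.eq_of_infinite_eval_eq
  refine (Set.infinite_range_of_injective Complex.ofReal_injective).mono ?_
  rintro _ ⟨s, rfl⟩
  simp only [Set.mem_ofPred_eq, key]
  exact h s

/-- Any square matrix becomes invertible after adding a suitable diagonal matrix of signs. -/
lemma Matrix.exists_sign_det_add_diagonal_ne_zero {n : ℕ} (M : Matrix (Fin n) (Fin n) ℂ) :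
    ∃ d : Fin n → ℝ, (∀ i, d i * d i = 1) ∧
      (M + diagonal (fun i => (d i : ℂ))).det ≠ 0 := by
  induction n with
  | zero => exact ⟨fun _ => 1, by simp, by simp⟩
  | succ n ih =>
    obtain ⟨d, hd, hdet⟩ := ih (M.submatrix Fin.succ Fin.succ)
    have expand : ∀ s : ℝ,
        (M + diagonal (fun i => ((Fin.cons s d : Fin (n + 1) → ℝ) i : ℂ))).det =
        (M + diagonal (fun i => ((Fin.cons 0 d : Fin (n + 1) → ℝ) i : ℂ))).det +
        s * (M.submatrix Fin.succ Fin.succ + diagonal (fun i => (d i : ℂ))).det := by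
      intro s
      have minors : ∀ (r : ℝ) (j : Fin (n + 1)),
          (M + diagonal (fun i => ((Fin.cons r d : Fin (n + 1) → ℝ) i : ℂ))).submatrix
            Fin.succ j.succAbove =
          (M + diagonal (fun i => ((Fin.cons 0 d : Fin (n + 1) → ℝ) i : ℂ))).submatrix
            Fin.succ j.succAbove := by
        intro r j
        ext a b
        simp [diagonal_apply]
      have corner : (M + diagonal (fun i => ((Fin.cons 0 d : Fin (n + 1) → ℝ) i : ℂ))).submatrix
          Fin.succ Fin.succ =
          M.submatrix Fin.succ Fin.succ + diagonal (fun i => (d i : ℂ)) := by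
        ext a b
        simp [diagonal_apply]
      rw [det_succ_row_zero, det_succ_row_zero]
      simp only [minors s]
      rw [Fin.sum_univ_succ, Fin.sum_univ_succ]
      simp only [Fin.succAbove_zero, corner]
      simp [(Fin.succ_ne_zero _).symm]
      ring
    have signs : ∀ s : ℝ, s * s = 1 →
        ∀ i, (Fin.cons s d : Fin (n + 1) → ℝ) i * (Fin.cons s d : Fin (n + 1) → ℝ) i = 1 := by
      intro s hs i
      refine Fin.cases ?_ (fun j => ?_) i
      · simpa using hs
      · simpa using hd j
    by_contra! hzero
    have hpos := hzero _ (signs 1 (by norm_num))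
    have hneg := hzero _ (signs (-1) (by norm_num))
    rw [expand] at hpos hneg
    apply hdet
    push_cast at hpos hneg
    linear_combination (hpos - hneg) / 2

/-- If `A` is a real skew-symmetric matrix, then `1 + A` is invertible. -/
lemma Matrix.isUnit_det_one_add_of_transpose_eq_neg {ι : Type*} [Fintype ι] [DecidableEq ι]
    (A : Matrix ι ι ℝ) (hA : Aᵀ = -A) : IsUnit (1 + A).det := by
  rw [isUnit_iff_ne_zero]
  intro h
  obtain ⟨v, hv, hv0⟩ := exists_mulVec_eq_zero_iff.mpr h
  have skew : v ⬝ᵥ A *ᵥ v = 0 := by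
    have : v ⬝ᵥ A *ᵥ v = -(v ⬝ᵥ A *ᵥ v) := by
      conv_lhs => rw [dotProduct_mulVec, ← mulVec_transpose, hA, neg_mulVec, neg_dotProduct,
        dotProduct_comm]
    linarith
  apply hv
  have := congrArg (v ⬝ᵥ ·) hv0
  simpa [add_mulVec, skew] using this

section Cayley

variable {ι R : Type*} [Fintype ι] [DecidableEq ι] [CommRing R]

/-- The Cayley transform of a skew-symmetric matrix is orthogonal. -/
lemma Matrix.cayley_transpose_mul_self (A : Matrix ι ι R) (hA : Aᵀ = -A)
    (hu : IsUnit (1 + A).det) :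
    ((1 - A) * (1 + A)⁻¹)ᵀ * ((1 - A) * (1 + A)⁻¹) = 1 := by
  have htrans : (1 + A)ᵀ = 1 - A := by simp [hA, sub_eq_add_neg]
  have hu' : IsUnit (1 - A).det := by rwa [← htrans, det_transpose]
  have htrans' : (1 - A)ᵀ = 1 + A := by simp [hA]
  have hcomm : (1 + A) * (1 - A) = (1 - A) * (1 + A) := by noncomm_ring
  rw [transpose_mul, transpose_nonsing_inv, htrans, htrans']
  calc (1 - A)⁻¹ * (1 + A) * ((1 - A) * (1 + A)⁻¹)
      = (1 - A)⁻¹ * ((1 + A) * (1 - A)) * (1 + A)⁻¹ := by simp only [Matrix.mul_assoc]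
    _ = ((1 - A)⁻¹ * (1 - A)) * ((1 + A) * (1 + A)⁻¹) := by
      rw [hcomm]; simp only [Matrix.mul_assoc]
    _ = 1 := by rw [nonsing_inv_mul _ hu', mul_nonsing_inv _ hu, Matrix.mul_one]

/-- The Cayley transform of a skew-symmetric matrix has determinant one. -/
lemma Matrix.det_cayley (A : Matrix ι ι R) (hA : Aᵀ = -A) (hu : IsUnit (1 + A).det) :
    ((1 - A) * (1 + A)⁻¹).det = 1 := by
  have htrans : (1 + A)ᵀ = 1 - A := by simp [hA, sub_eq_add_neg]
  rw [det_mul, ← htrans, det_transpose, ← det_mul, mul_nonsing_inv _ hu, det_one]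

/-- The Cayley transform of an orthogonal matrix is skew-symmetric. -/
lemma Matrix.transpose_cayley_of_orthogonal (M : Matrix ι ι R) (hM : Mᵀ * M = 1)
    (hu : IsUnit (1 + M).det) :
    ((1 - M) * (1 + M)⁻¹)ᵀ = -((1 - M) * (1 + M)⁻¹) := by
  have hu' : IsUnit (1 + Mᵀ).det := by
    rwa [← det_transpose, transpose_add, transpose_one, transpose_transpose]
  have hcross : (1 - Mᵀ) * (1 + M) = -((1 + Mᵀ) * (1 - M)) := by
    simp only [Matrix.sub_mul, Matrix.mul_add, Matrix.add_mul, Matrix.mul_sub, hM,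
      Matrix.one_mul, Matrix.mul_one]
    abel
  rw [transpose_mul, transpose_nonsing_inv, transpose_add, transpose_sub, transpose_one]
  calc (1 + Mᵀ)⁻¹ * (1 - Mᵀ)
      = (1 + Mᵀ)⁻¹ * ((1 - Mᵀ) * (1 + M)) * (1 + M)⁻¹ := by
        rw [Matrix.mul_assoc, Matrix.mul_assoc, mul_nonsing_inv _ hu, Matrix.mul_one]
    _ = -((1 + Mᵀ)⁻¹ * (1 + Mᵀ) * ((1 - M) * (1 + M)⁻¹)) := by
        rw [hcross]; simp only [Matrix.mul_neg, Matrix.neg_mul, Matrix.mul_assoc]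
    _ = -((1 - M) * (1 + M)⁻¹) := by rw [nonsing_inv_mul _ hu', Matrix.one_mul]

/-- An orthogonal matrix without eigenvalue `-1` has determinant one. -/
lemma Matrix.det_eq_one_of_orthogonal (M : Matrix ι ι R) (hM : Mᵀ * M = 1)
    (hu : IsUnit (1 + M).det) : M.det = 1 := by
  have h : (1 + M).det = (1 + M).det * M.det := by
    conv_rhs => rw [← det_transpose (1 + M), ← det_mul, transpose_add, transpose_one,
      Matrix.add_mul, hM, Matrix.one_mul, add_comm]
  exact (hu.mul_left_cancel (by rw [mul_one]; exact h)).symm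

end Cayley

/-- Invariance under Cayley transforms, without denominators, for real skew-symmetric matrices. -/
lemma MvPolynomial.eval_one_sub_eq_eval_one_add_of_real
    {n : ℕ} (p : MvPolynomial (Fin n) ℂ)
    (hinv : ∀ M : Matrix (Fin n) (Fin n) ℝ, Mᵀ * M = 1 → M.det = 1 →
      ∀ x : Fin n → ℂ,
        MvPolynomial.eval ((M.map (fun a : ℝ => (a : ℂ))).mulVec x) p =
          MvPolynomial.eval x p)
    (A : Matrix (Fin n) (Fin n) ℝ)
    (hA : Aᵀ = -A) (y : Fin n → ℂ) :
    MvPolynomial.eval ((1 - A.map (fun a : ℝ => (a : ℂ))) *ᵥ y) p =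
      MvPolynomial.eval ((1 + A.map (fun a : ℝ => (a : ℂ))) *ᵥ y) p := by
  have hu := isUnit_det_one_add_of_transpose_eq_neg A hA
  have h := hinv _ (cayley_transpose_mul_self A hA hu) (det_cayley A hA hu)
    ((1 + A.map (fun a : ℝ => (a : ℂ))) *ᵥ y)
  have hadd : (1 + A.map (fun a : ℝ => (a : ℂ))) = (1 + A).map Complex.ofRealHom := by
    ext i j; simp [Matrix.one_apply, apply_ite]
  have hsub : (1 - A.map (fun a : ℝ => (a : ℂ))) = (1 - A).map Complex.ofRealHom := by
    ext i j; simp [Matrix.one_apply, apply_ite]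
  rw [← h, mulVec_mulVec]
  congr 3
  rw [hadd, hsub]
  change _ = ((1 - A) * (1 + A)⁻¹).map Complex.ofRealHom * _
  rw [← Matrix.map_mul, Matrix.mul_assoc, nonsing_inv_mul _ hu, Matrix.mul_one]

/-- Invariance under Cayley transforms, without denominators, for complex skew-symmetric
matrices. -/
lemma MvPolynomial.eval_one_sub_eq_eval_one_add
    {n : ℕ} (p : MvPolynomial (Fin n) ℂ)
    (hinv : ∀ M : Matrix (Fin n) (Fin n) ℝ, Mᵀ * M = 1 → M.det = 1 →
      ∀ x : Fin n → ℂ,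
        MvPolynomial.eval ((M.map (fun a : ℝ => (a : ℂ))).mulVec x) p =
          MvPolynomial.eval x p)
    (A : Matrix (Fin n) (Fin n) ℂ)
    (hA : Aᵀ = -A) (y : Fin n → ℂ) :
    MvPolynomial.eval ((1 - A) *ᵥ y) p = MvPolynomial.eval ((1 + A) *ᵥ y) p := by
  set B := A.map Complex.re with hB
  set C := A.map Complex.im with hC
  have hAij : ∀ i j, A j i = -A i j := fun i j => congrFun (congrFun hA i) j
  have hBC : A = B.map (fun a : ℝ => (a : ℂ)) + Complex.I • C.map (fun a : ℝ => (a : ℂ)) := by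
    ext i j
    simp only [hB, hC, Matrix.add_apply, Matrix.smul_apply, Matrix.map_apply, smul_eq_mul]
    rw [mul_comm, Complex.re_add_im]
  have h := MvPolynomial.eval_line_eq_of_real p p
    ((1 - B.map (fun a : ℝ => (a : ℂ))) *ᵥ y) (-(C.map (fun a : ℝ => (a : ℂ)) *ᵥ y))
    ((1 + B.map (fun a : ℝ => (a : ℂ))) *ᵥ y) (C.map (fun a : ℝ => (a : ℂ)) *ᵥ y)
    (fun t => ?_) Complex.I
  · rw [hBC]
    convert h using 2
    · simp only [sub_mulVec, add_mulVec, smul_mulVec, smul_neg, ← sub_eq_add_neg, sub_sub]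
    · simp only [add_mulVec, smul_mulVec, add_assoc]
  · have ht := eval_one_sub_eq_eval_one_add_of_real p hinv (B + t • C)
      (by ext i j; simp [hB, hC, hAij i j]; ring) y
    have hmap : (B + t • C).map (fun a : ℝ => (a : ℂ)) =
        B.map (fun a : ℝ => (a : ℂ)) + (t : ℂ) • C.map (fun a : ℝ => (a : ℂ)) := by
      ext i j; simp
    rw [hmap] at ht
    convert ht using 2
    · simp only [sub_mulVec, add_mulVec, smul_mulVec, smul_neg, ← sub_eq_add_neg, sub_sub]
    · simp only [add_mulVec, smul_mulVec, add_assoc]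

/-- Invariance under complex orthogonal matrices without eigenvalue `-1`. -/
lemma MvPolynomial.eval_mulVec_eq_of_isUnit_det_one_add
    {n : ℕ} (p : MvPolynomial (Fin n) ℂ)
    (hinv : ∀ M : Matrix (Fin n) (Fin n) ℝ, Mᵀ * M = 1 → M.det = 1 →
      ∀ x : Fin n → ℂ,
        MvPolynomial.eval ((M.map (fun a : ℝ => (a : ℂ))).mulVec x) p =
          MvPolynomial.eval x p)
    (M : Matrix (Fin n) (Fin n) ℂ)
    (hM : Mᵀ * M = 1) (hu : IsUnit (1 + M).det) (x : Fin n → ℂ) :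
    MvPolynomial.eval (M *ᵥ x) p = MvPolynomial.eval x p := by
  have h := eval_one_sub_eq_eval_one_add p hinv _ (transpose_cayley_of_orthogonal M hM hu)
    ((1 + M) *ᵥ ((2⁻¹ : ℂ) • x))
  have hcancel : (1 - M) * (1 + M)⁻¹ * (1 + M) = 1 - M := by
    rw [Matrix.mul_assoc, nonsing_inv_mul _ hu, Matrix.mul_one]
  rw [mulVec_mulVec, mulVec_mulVec, Matrix.sub_mul, Matrix.add_mul, hcancel, Matrix.one_mul] at h
  have h₁ : 1 + M - (1 - M) = (2 : ℂ) • M := by rw [two_smul]; abel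
  have h₂ : 1 + M + (1 - M) = (2 : ℂ) • (1 : Matrix (Fin n) (Fin n) ℂ) := by
    rw [two_smul]; abel
  rw [h₁, h₂] at h
  simpa [smul_mulVec, mulVec_smul, smul_smul] using h

/-- **`SO(n,ℝ)`-invariance implies `SO(n,ℂ)`-invariance for complex polynomials.**
If `p ∈ ℂ[x₁,…,xₙ]` satisfies `p(Mx) = p(x)` for every real special orthogonal matrix `M`
(acting on `ℂ^n` via its entries regarded as complex numbers), then `p(Mx) = p(x)` for
every complex special orthogonal matrix `M`. An instance of: the invariants of a linearly
reductive group over `ℂ` coincide with those of its maximal compact subgroup. -/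
theorem real_special_orthogonal_invariance_extends
    {n : ℕ} (p : MvPolynomial (Fin n) ℂ)
    (hinv : ∀ M : Matrix (Fin n) (Fin n) ℝ, Mᵀ * M = 1 → M.det = 1 →
      ∀ x : Fin n → ℂ,
        MvPolynomial.eval ((M.map (fun a : ℝ => (a : ℂ))).mulVec x) p =
          MvPolynomial.eval x p) :
    ∀ M : Matrix (Fin n) (Fin n) ℂ, Mᵀ * M = 1 → M.det = 1 →
      ∀ x : Fin n → ℂ,
        MvPolynomial.eval (M.mulVec x) p = MvPolynomial.eval x p := by
  intro M hM hMdet x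
  obtain ⟨d, hd, hdet⟩ := exists_sign_det_add_diagonal_ne_zero M
  have hdC : ∀ i, (d i : ℂ) * d i = 1 := fun i => by exact_mod_cast hd i
  set D : Matrix (Fin n) (Fin n) ℂ := diagonal (fun i => (d i : ℂ)) with hD
  have hDD : D * D = 1 := by
    rw [hD, diagonal_mul_diagonal]; simp only [hdC, diagonal_one]
  have hDt : Dᵀ = D := diagonal_transpose _
  have hDM : (D * M)ᵀ * (D * M) = 1 := by
    rw [transpose_mul, hDt, Matrix.mul_assoc, ← Matrix.mul_assoc D D, hDD, Matrix.one_mul, hM]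
  have hu : IsUnit (1 + D * M).det := by
    have hfac : 1 + D * M = D * (M + D) := by rw [Matrix.mul_add, hDD, add_comm]
    rw [hfac, det_mul, isUnit_iff_ne_zero]
    refine mul_ne_zero (fun h => ?_) hdet
    have := congrArg det hDD
    simp [h] at this
  have hdetD : (diagonal d).det = 1 := by
    have h₁ := det_eq_one_of_orthogonal _ hDM hu
    rw [det_mul, hMdet, mul_one, hD, det_diagonal] at h₁
    rw [det_diagonal]
    exact_mod_cast h₁
  have hmap : (diagonal d).map (fun a : ℝ => (a : ℂ)) = D := by
    rw [hD, diagonal_map Complex.ofReal_zero]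
  have h := hinv (diagonal d)
    (by rw [diagonal_transpose, diagonal_mul_diagonal]; simp only [hd, diagonal_one])
    hdetD (M *ᵥ x)
  rw [hmap, mulVec_mulVec] at h
  rw [← h]
  exact MvPolynomial.eval_mulVec_eq_of_isUnit_det_one_add p hinv _ hDM hu x
end

section
/- Let d ≥ 1 and 1 ≤ n ≤ d, and consider the polynomial ring ℂ[x_{i,k} : 1 ≤ i ≤ n, 1 ≤ k ≤ d] in the coordinates of n vectors in ℂ^d. Then the n(n+1)/2 dot-product polynomials s_{ij} = ∑_{k=1}^d x_{i,k} x_{j,k}, for 1 ≤ i ≤ j ≤ n, are algebraically independent over ℂ. -/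
open scoped ComplexOrder MatrixOrder Matrix.Norms.L2Operator in
/-- A positive semidefinite matrix factors as `Bᴴ * B`. -/
theorem Matrix.PosSemidef.exists_eq_conjTranspose_mul_self {𝕜 m : Type*} [RCLike 𝕜] [Fintype m]
    [DecidableEq m] {A : Matrix m m 𝕜} (hA : A.PosSemidef) :
    ∃ B : Matrix m m 𝕜, A = B.conjTranspose * B :=
  CStarAlgebra.nonneg_iff_eq_star_mul_self.mp hA.nonneg

/-- A real symmetric matrix that is diagonally dominant with nonnegative diagonal is positive
semidefinite. -/
theorem Matrix.IsHermitian.posSemidef_of_sum_row_le_diag {m : Type*} [Fintype m] [DecidableEq m]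
    {A : Matrix m m ℝ} (hA : A.IsHermitian)
    (h : ∀ i, ∑ j ∈ Finset.univ.erase i, ‖A i j‖ ≤ A i i) : A.PosSemidef := by
  refine hA.posSemidef_iff_eigenvalues_nonneg.mpr fun i => ?_
  have hμ : Module.End.HasEigenvalue (Matrix.toLin' A) (hA.eigenvalues i) := by
    rw [Module.End.hasEigenvalue_iff_mem_spectrum, Matrix.spectrum_toLin']
    exact hA.eigenvalues_mem_spectrum_real i
  obtain ⟨k, hk⟩ := eigenvalue_mem_ball hμ
  rw [Metric.mem_closedBall, Real.dist_eq, abs_le] at hk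
  simp only [Pi.zero_apply]
  linarith [h k, hk.1]

/-- A real positive semidefinite matrix of size `n` is the Gram matrix of `n` vectors of length
`d`, for every `d ≥ n`. -/
theorem Matrix.PosSemidef.exists_sum_mul_eq {d n : ℕ} (hnd : n ≤ d)
    {A : Matrix (Fin n) (Fin n) ℝ} (hA : A.PosSemidef) :
    ∃ x : Fin n → Fin d → ℝ, ∀ i j, ∑ k, x i k * x j k = A i j := by
  obtain ⟨B, rfl⟩ := hA.exists_eq_conjTranspose_mul_self
  obtain ⟨m, rfl⟩ := Nat.exists_eq_add_of_le hnd
  refine ⟨fun i => Fin.append (fun k => B k i) 0, fun i j => ?_⟩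
  simp [Fin.sum_univ_add, Matrix.mul_apply]

/-- **Algebraic independence of the dot products when `n ≤ d`.**
For `1 ≤ n ≤ d`, consider the polynomial ring `ℂ[x_{i,k}]` in the coordinates of `n`
vectors in `ℂ^d`. The `n(n+1)/2` dot-product polynomials
`s_{ij} = ∑ₖ x_{i,k} x_{j,k}` for `i ≤ j` are algebraically independent over `ℂ`. -/
theorem dot_products_algebraicIndependent
    (d n : ℕ) (hd : 1 ≤ d) (hn : 1 ≤ n) (hnd : n ≤ d) :
    AlgebraicIndependent ℂ
      (fun q : {q : Fin n × Fin n // q.1 ≤ q.2} =>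
        ∑ k : Fin d,
          MvPolynomial.X (R := ℂ) (q.1.1, k) * MvPolynomial.X (q.1.2, k)) := by
  rw [algebraicIndependent_iff]
  intro p hp
  -- `p` vanishes on a box of entries of diagonally dominant symmetric matrices.
  let I : {q : Fin n × Fin n // q.1 ≤ q.2} → Set ℝ := fun q =>
    if q.1.1 = q.1.2 then Set.Ici (n : ℝ) else Set.Icc 0 1
  have hI : ∀ q, (I q).Infinite := by
    intro q
    by_cases h : q.1.1 = q.1.2
    · simpa [I, h] using Set.Ici_infinite (n : ℝ)
    · simpa [I, h] using Set.Icc_infinite (zero_lt_one' ℝ)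
  refine MvPolynomial.funext_set (fun q => Complex.ofReal '' I q)
    (fun q => (hI q).image Complex.ofReal_injective.injOn) fun v hv => ?_
  choose w hw hwv using fun q => hv q (Set.mem_univ q)
  let A : Matrix (Fin n) (Fin n) ℝ := Matrix.of fun i j =>
    w ⟨(min i j, max i j), min_le_max⟩
  have hA : A.IsHermitian := by
    ext i j
    simp [A, min_comm, max_comm]
  have hdom : ∀ i, ∑ j ∈ Finset.univ.erase i, ‖A i j‖ ≤ A i i := by
    intro i
    have hdiag : (n : ℝ) ≤ A i i := by
      simpa [I, A] using hw ⟨(min i i, max i i), min_le_max⟩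
    have hoff : ∀ j ∈ Finset.univ.erase i, ‖A i j‖ ≤ 1 := by
      intro j hj
      have hij : min i j ≠ max i j := by
        simpa [eq_comm] using hj
      have := hw ⟨(min i j, max i j), min_le_max⟩
      simp only [I, if_neg hij, Set.mem_Icc] at this
      exact abs_le.mpr ⟨by simp only [A, Matrix.of_apply]; linarith [this.1], this.2⟩
    calc ∑ j ∈ Finset.univ.erase i, ‖A i j‖ ≤ ∑ j ∈ Finset.univ.erase i, (1 : ℝ) :=
          Finset.sum_le_sum hoff
      _ ≤ ∑ j : Fin n, (1 : ℝ) :=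
          Finset.sum_le_sum_of_subset_of_nonneg (Finset.erase_subset _ _) (by simp)
      _ = n := by simp
      _ ≤ A i i := hdiag
  obtain ⟨x, hx⟩ := (hA.posSemidef_of_sum_row_le_diag hdom).exists_sum_mul_eq hnd
  have hv' : v = fun q => MvPolynomial.aeval (fun r : Fin n × Fin d => (x r.1 r.2 : ℂ))
      (∑ k : Fin d, MvPolynomial.X (R := ℂ) (q.1.1, k) * MvPolynomial.X (q.1.2, k)) := by
    ext q
    have hq : A q.1.1 q.1.2 = w q := by
      simp [A, q.2]
    rw [← hwv q, ← hq, ← hx]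
    simp
  rw [← MvPolynomial.aeval_eq_eval, hv', map_zero, ← MvPolynomial.comp_aeval_apply, hp, map_zero]
end
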